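/- Let m ≥ 1, n ≥ 2, let μ be a phase-symmetric probability measure on ℂ^m (coordinates indexed by ZMod m), and let x_1, …, x_M ∈ ℂ^n be any family of 1-sparse plaintexts. Then there exist complex m×n matrices Q and Q' such that Q ≠ θ·Q' for every θ ∈ ℂ with |θ| = 1, and yet for every k ∈ {1, …, M} the pushforward of μ under h ↦ h ⊛ (Q x_k) equals the pushforward of μ under h ↦ h ⊛ (Q' x_k). In other words, for phase-symmetric filters and 1-sparse plaintexts, the key can never be retrieved. -/

import Mathlib

open MeasureTheory Complex

/-- Circular convolution on ℂ^m: (h ⊛ v)(i) = ∑ⱼ h(j) · v(i − j). -/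
noncomputable def cconv {m : ℕ} [NeZero m] (h v : ZMod m → ℂ) : ZMod m → ℂ :=
  fun i => ∑ j : ZMod m, h j * v (i - j)

/-- A measure on ℂ^m is phase-symmetric if it is invariant under multiplication
by any global unit scalar. -/
def PhaseSymmetric {m : ℕ} (μ : Measure (ZMod m → ℂ)) : Prop :=
  ∀ θ : ℂ, ‖θ‖ = 1 → μ.map (fun h => θ • h) = μ

/-- A vector x ∈ ℂ^n is s-sparse if its support has at most s elements. -/
def IsSparse {n : ℕ} (s : ℕ) (x : Fin n → ℂ) : Prop :=
  Set.ncard {i | x i ≠ 0} ≤ s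

/-- A `1`-sparse vector is an eigenvector, up to a unit scalar, of every entrywise
multiplication by unit scalars. -/
lemma IsSparse.exists_mul_eq_smul {n : ℕ} {x : Fin n → ℂ} (hx : IsSparse 1 x)
    {ε : Fin n → ℂ} (hε : ∀ i, ‖ε i‖ = 1) :
    ∃ c : ℂ, ‖c‖ = 1 ∧ (fun i => ε i * x i) = c • x := by
  have hsub := (Set.ncard_le_one (Set.toFinite _)).1 hx
  by_cases h : ∃ i, x i ≠ 0
  · obtain ⟨i, hi⟩ := h
    refine ⟨ε i, hε i, funext fun j => ?_⟩
    by_cases hj : x j = 0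
    · simp [hj]
    · simp [hsub j hj i hi]
  · push Not at h
    exact ⟨1, by simp, funext fun j => by simp [h j]⟩

lemma cconv_smul_right {m : ℕ} [NeZero m] (θ : ℂ) (h v : ZMod m → ℂ) :
    cconv h (θ • v) = cconv (θ • h) v := by
  funext i
  simp only [cconv, Pi.smul_apply, smul_eq_mul]
  exact Finset.sum_congr rfl fun j _ => by ring

lemma measurable_cconv_left {m : ℕ} [NeZero m] (v : ZMod m → ℂ) :
    Measurable fun h => cconv h v := by
  unfold cconv
  fun_prop

/-- Under a phase-symmetric filter, rotating the signal by a global phase does not change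
the law of the convolution. -/
lemma PhaseSymmetric.map_cconv_smul {m : ℕ} [NeZero m] {μ : Measure (ZMod m → ℂ)}
    (hμ : PhaseSymmetric μ) {θ : ℂ} (hθ : ‖θ‖ = 1) (v : ZMod m → ℂ) :
    μ.map (fun h => cconv h (θ • v)) = μ.map (fun h => cconv h v) := by
  conv_rhs => rw [← hμ θ hθ, Measure.map_map (measurable_cconv_left v) (by fun_prop)]
  simp only [cconv_smul_right, Function.comp_def]

/-- For phase-symmetric filters and 1-sparse plaintexts, the key can never be
retrieved. -/
theorem one_sparse_no_key_retrieval (m n M : ℕ) [NeZero m] (hm : 1 ≤ m) (hn : 2 ≤ n)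
    (μ : Measure (ZMod m → ℂ)) [IsProbabilityMeasure μ] (hμ : PhaseSymmetric μ)
    (x : Fin M → Fin n → ℂ) (hx : ∀ k, IsSparse 1 (x k)) :
    ∃ Q Q' : Matrix (ZMod m) (Fin n) ℂ,
      (∀ θ : ℂ, ‖θ‖ = 1 → Q ≠ θ • Q') ∧
      ∀ k : Fin M,
        μ.map (fun h => cconv h (Q.mulVec (x k))) =
        μ.map (fun h => cconv h (Q'.mulVec (x k))) := by
  let ε : Fin n → ℂ := fun i => if (i : ℕ) = 0 then 1 else -1
  refine ⟨Matrix.of fun _ j => ε j, Matrix.of fun _ _ => 1, fun θ _ h => ?_, fun k => ?_⟩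
  · have h0 : (1 : ℂ) = θ := by simpa [ε] using congrFun (congrFun h 0) ⟨0, by omega⟩
    have h1 : (-1 : ℂ) = θ := by simpa [ε] using congrFun (congrFun h 0) ⟨1, by omega⟩
    norm_num [← h0] at h1
  · have hε : ∀ i, ‖ε i‖ = 1 := fun i => by by_cases hi : (i : ℕ) = 0 <;> simp [ε, hi]
    obtain ⟨c, hc, hcx⟩ := (hx k).exists_mul_eq_smul hε
    have hQ : (Matrix.of fun (_ : ZMod m) j => ε j).mulVec (x k) =
        c • (Matrix.of fun (_ : ZMod m) (_ : Fin n) => (1 : ℂ)).mulVec (x k) := by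
      rw [← Matrix.mulVec_smul, ← hcx]
      ext i
      simp [Matrix.mulVec, dotProduct]
    rw [hQ, hμ.map_cconv_smul hc]
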